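/- Let μ ∈ ℤⁿ, let y₁ = τ_α(y(p,e,b,g)) for some p ∈ ℂ, e ∈ ℂ×, b, g ∈ ℂ^{k−1}, and let y₂ ∈ Gr_{μ+α}. Then Φ_α(m(y₁,y₂)) = Φ_α(y₁) = (b₁,…,b_{k−1}, e) and ζ_α(m(y₁,y₂)) = ζ_α(y₁) = (e g_{k−1}, e g_{k−2}, …, e g₁, e(p + ∑_{i=1}^{k−1} b_i g_i)). -/

import Mathlib

open Matrix

noncomputable section

/-- `K = ℂ((t⁻¹))`, the field of formal Laurent series in `t⁻¹`.  We realize it as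
`LaurentSeries ℂ`, where the Laurent-series variable `X` plays the role of `t⁻¹`;
thus for `f : K`, `f.coeff j` is the coefficient of `t^{-j}`. -/
abbrev K : Type := LaurentSeries ℂ

/-- The element `t` (the inverse of the Laurent series variable). -/
def tK : K := (HahnSeries.single (-1 : ℤ) (1 : ℂ))

/-- The constant embedding `ℂ → K`. -/
def Cc (z : ℂ) : K := HahnSeries.C z

/-- `f ∈ 𝒪 = ℂ[[t⁻¹]]` : no positive powers of `t`. -/
def memO (f : K) : Prop := ∀ j : ℤ, j < 0 → f.coeff j = 0

/-- `f ∈ 𝒪₁ = t⁻¹ℂ[[t⁻¹]]`. -/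
def memO1 (f : K) : Prop := ∀ j : ℤ, j ≤ 0 → f.coeff j = 0

/-- `f ∈ ℂ[t]`. -/
def memPoly (f : K) : Prop := ∀ j : ℤ, 0 < j → f.coeff j = 0

/-- Upper unitriangular matrix. -/
def IsUpperUni {R : Type*} [Zero R] [One R] {m : ℕ} (M : Matrix (Fin m) (Fin m) R) : Prop :=
  (∀ i, M i i = 1) ∧ ∀ i j : Fin m, j < i → M i j = 0

/-- Lower unitriangular matrix. -/
def IsLowerUni {R : Type*} [Zero R] [One R] {m : ℕ} (M : Matrix (Fin m) (Fin m) R) : Prop :=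
  (∀ i, M i i = 1) ∧ ∀ i j : Fin m, i < j → M i j = 0

/-- `M ∈ N₁[[t⁻¹]]` : upper unitriangular with off-diagonal entries in `𝒪₁`. -/
def MemN1 {m : ℕ} (M : Matrix (Fin m) (Fin m) K) : Prop :=
  IsUpperUni M ∧ ∀ i j : Fin m, i ≠ j → memO1 (M i j)

/-- `M ∈ N₋,₁[[t⁻¹]]`. -/
def MemN1neg {m : ℕ} (M : Matrix (Fin m) (Fin m) K) : Prop :=
  IsLowerUni M ∧ ∀ i j : Fin m, i ≠ j → memO1 (M i j)

/-- `M ∈ T₁[[t⁻¹]]` : diagonal with entries in `1 + 𝒪₁`. -/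
def MemT1 {m : ℕ} (M : Matrix (Fin m) (Fin m) K) : Prop :=
  (∀ i j : Fin m, i ≠ j → M i j = 0) ∧ ∀ i, memO1 (M i i - 1)

/-- `M ∈ N[t]` : upper unitriangular with entries in `ℂ[t]`. -/
def MemNpoly {m : ℕ} (M : Matrix (Fin m) (Fin m) K) : Prop :=
  IsUpperUni M ∧ ∀ i j : Fin m, memPoly (M i j)

/-- `M ∈ N₋[t]` : lower unitriangular with entries in `ℂ[t]`. -/
def MemNnegPoly {m : ℕ} (M : Matrix (Fin m) (Fin m) K) : Prop :=
  IsLowerUni M ∧ ∀ i j : Fin m, memPoly (M i j)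

/-- `t^ν = diag(t^{ν₁},…,t^{ν_m})`. -/
def tPow {m : ℕ} (ν : Fin m → ℤ) : Matrix (Fin m) (Fin m) K :=
  Matrix.diagonal fun i => tK ^ ν i

/-- `y = u · h · t^ν · l` is a Gauss factorization exhibiting membership in `Gr_ν`. -/
def IsGauss {m : ℕ} (ν : Fin m → ℤ) (y u h l : Matrix (Fin m) (Fin m) K) : Prop :=
  MemN1 u ∧ MemT1 h ∧ MemN1neg l ∧ y = u * h * tPow ν * l

/-- The matrix slice `Gr_ν = N₁[[t⁻¹]]·T₁[[t⁻¹]]·t^ν·N₋,₁[[t⁻¹]]`. -/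
def GrSlice {m : ℕ} (ν : Fin m → ℤ) : Set (Matrix (Fin m) (Fin m) K) :=
  { y | ∃ u h l, IsGauss ν y u h l }

/-- Block embedding `τ_α : Mat_{k+1} → Mat_n` into (1-indexed) rows and columns `r₁,…,r₁+k`,
identity outside this block. -/
def blockEmbed {R : Type*} [Zero R] [One R] (n r₁ k : ℕ)
    (g : Matrix (Fin (k+1)) (Fin (k+1)) R) : Matrix (Fin n) (Fin n) R :=
  fun i j =>
    if h : r₁ - 1 ≤ (i : ℕ) ∧ (i : ℕ) ≤ r₁ - 1 + k ∧ r₁ - 1 ≤ (j : ℕ) ∧ (j : ℕ) ≤ r₁ - 1 + k then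
      g ⟨(i : ℕ) - (r₁ - 1), by omega⟩ ⟨(j : ℕ) - (r₁ - 1), by omega⟩
    else if i = j then 1 else 0

/-- The coweight `α` of `PGL_n` : `α_{r₁} = 1`, `α_{r₂+1} = -1` (1-indexed), all other
entries `0`. -/
def alphaCo (n r₁ r₂ : ℕ) : Fin n → ℤ :=
  fun i => if (i : ℕ) = r₁ - 1 then 1 else if (i : ℕ) = r₂ then -1 else 0

/-- The matrix `y(p,e,b,g)` (matrix representative of a point of the open Zastava
`Gr⁰_{-α}`), a `(k+1)×(k+1)` matrix over `ℂ[t] ⊆ K`. -/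
def ymat (k : ℕ) (p e : ℂ) (b g : Fin (k-1) → ℂ) :
    Matrix (Fin (k+1)) (Fin (k+1)) K :=
  fun i j =>
    if _hi0 : (i : ℕ) = 0 then
      (if _hjk : (j : ℕ) = k then Cc e else 0)
    else if _hik : (i : ℕ) = k then
      (if _hj0 : (j : ℕ) = 0 then Cc (-e⁻¹)
       else if _hjk : (j : ℕ) = k then tK - Cc (p + ∑ l : Fin (k-1), b l * g l)
       else Cc (-(g ⟨k - (j : ℕ) - 1, by have := j.isLt; omega⟩)))
    else
      (if _hji : (j : ℕ) = (i : ℕ) then 1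
       else if _hjk : (j : ℕ) = k then Cc (b ⟨k - (i : ℕ) - 1, by have := i.isLt; omega⟩)
       else 0)

/-- The matrix `x₋(v)` over `K` : identity except for the bottom row `(v_k,…,v₁,1)`. -/
def xminusK (k : ℕ) (v : Fin k → ℂ) : Matrix (Fin (k+1)) (Fin (k+1)) K :=
  fun i j =>
    if _hik : (i : ℕ) = k then
      (if _hjk : (j : ℕ) = k then 1 else Cc (v ⟨k - (j : ℕ) - 1, by have := j.isLt; omega⟩))
    else if i = j then 1 else 0

/-- `Φ_α(y)` read off from the `N₁[[t⁻¹]]`-factor `u` of a Gauss factorization of `y`. -/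
def PhiOf (n r₂ k : ℕ) (hrn : r₂ < n) (u : Matrix (Fin n) (Fin n) K) : Fin k → ℂ :=
  fun a => (u ⟨r₂ - 1 - (a : ℕ), by omega⟩ ⟨r₂, hrn⟩).coeff 1

/-- `ζ_α(y)` read off from the `N₁[[t⁻¹]]`-factor `u` of a Gauss factorization of `y`. -/
def ZetaOf (n r₁ r₂ k : ℕ) (hr1 : 1 ≤ r₁) (hrr : r₁ ≤ r₂) (hrn : r₂ < n)
    (hk : k = r₂ - r₁ + 1) (u : Matrix (Fin n) (Fin n) K) : Fin k → ℂ :=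
  fun a =>
    if _ha : (a : ℕ) = k - 1 then (u ⟨r₁ - 1, by omega⟩ ⟨r₂, hrn⟩).coeff 2
    else (u ⟨r₁ - 1, by omega⟩ ⟨r₁ + (a : ℕ), by have := a.isLt; omega⟩).coeff 1

/-- `ξ_α(y)`, computed from the `N₁[[t⁻¹]]`-factor `u` of a Gauss factorization of `y`. -/
def xiOf (n r₁ r₂ k : ℕ) (hr1 : 1 ≤ r₁) (hrr : r₁ ≤ r₂) (hrn : r₂ < n)
    (hk : k = r₂ - r₁ + 1) (u : Matrix (Fin n) (Fin n) K) : Matrix (Fin n) (Fin n) K :=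
  let c := PhiOf n r₂ k hrn u
  let z := ZetaOf n r₁ r₂ k hr1 hrr hrn hk u
  let e : ℂ := c ⟨k - 1, by omega⟩
  let b : Fin (k-1) → ℂ := fun i => c ⟨(i : ℕ), by have := i.isLt; omega⟩
  let g : Fin (k-1) → ℂ := fun i => z ⟨k - (i : ℕ) - 2, by omega⟩ / e
  let p : ℂ := z ⟨k - 1, by omega⟩ / e - ∑ i : Fin (k-1), b i * g i
  blockEmbed n r₁ k (ymat k p e b g)

/-- `M` has identity submatrix in (1-indexed) rows and columns `r₁,…,r₁+k`. -/
def HasIdBlock {R : Type*} [Zero R] [One R] {n : ℕ} (r₁ k : ℕ)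
    (M : Matrix (Fin n) (Fin n) R) : Prop :=
  ∀ i j : Fin n, r₁ - 1 ≤ (i : ℕ) → (i : ℕ) ≤ r₁ - 1 + k →
    r₁ - 1 ≤ (j : ℕ) → (j : ℕ) ≤ r₁ - 1 + k →
    M i j = if i = j then 1 else 0

/-- `M ∈ N^α(K)` : upper unitriangular over `K` with identity `(k+1)×(k+1)`-block. -/
def MemNalphaK (n r₁ k : ℕ) (M : Matrix (Fin n) (Fin n) K) : Prop :=
  IsUpperUni M ∧ HasIdBlock r₁ k M

/-- `M ∈ N^α[t]`. -/
def MemNalphaPoly (n r₁ k : ℕ) (M : Matrix (Fin n) (Fin n) K) : Prop :=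
  MemNalphaK n r₁ k M ∧ ∀ i j : Fin n, memPoly (M i j)

/-- `M ∈ N(K)^α₁ = x_α(N_{1,k+1}[[t⁻¹]])·N^α(K)`. -/
def MemNKalpha1 (n r₁ k : ℕ) (M : Matrix (Fin n) (Fin n) K) : Prop :=
  ∃ (a : Matrix (Fin (k+1)) (Fin (k+1)) K) (u : Matrix (Fin n) (Fin n) K),
    MemN1 a ∧ MemNalphaK n r₁ k u ∧ M = blockEmbed n r₁ k a * u

/-- `z = π(x)` for the slice `Gr_ν` : `z ∈ Gr_ν` and `z = a·x·b` with `a ∈ N[t]`,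
`b ∈ N₋[t]`. -/
def IsPiOf {n : ℕ} (ν : Fin n → ℤ) (x z : Matrix (Fin n) (Fin n) K) : Prop :=
  z ∈ GrSlice ν ∧ ∃ a b, MemNpoly a ∧ MemNnegPoly b ∧ z = a * x * b

/-- The open Zastava slice `Gr⁰_{-α} ⊆ GL_n(K)` : matrices `τ_α(y(p,e,b,g))`. -/
def GrZeroNegAlpha (n r₁ k : ℕ) : Set (Matrix (Fin n) (Fin n) K) :=
  { M | ∃ (p e : ℂ) (b g : Fin (k-1) → ℂ), e ≠ 0 ∧ M = blockEmbed n r₁ k (ymat k p e b g) }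

/-- `μ + α`. -/
def addAlpha (n r₁ r₂ : ℕ) (μ : Fin n → ℤ) : Fin n → ℤ :=
  fun i => μ i + alphaCo n r₁ r₂ i


/-- `f` has no coefficient at `t^{-j}` for `j < d`. -/
def VanishBelow (d : ℤ) (f : K) : Prop := ∀ j : ℤ, j < d → f.coeff j = 0

namespace VanishBelow

variable {d d' : ℤ} {f g : K}

lemma zero : VanishBelow d 0 := fun _ _ => by simp

lemma mono (hf : VanishBelow d f) (h : d' ≤ d) : VanishBelow d' f :=
  fun j hj => hf j (by omega)

lemma add (hf : VanishBelow d f) (hg : VanishBelow d g) : VanishBelow d (f + g) :=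
  fun j hj => by simp [hf j hj, hg j hj]

lemma sub (hf : VanishBelow d f) (hg : VanishBelow d g) : VanishBelow d (f - g) :=
  fun j hj => by simp [hf j hj, hg j hj]

lemma mul (hf : VanishBelow d f) (hg : VanishBelow d' g) : VanishBelow (d + d') (f * g) := by
  intro j hj
  rw [HahnSeries.coeff_mul]
  refine Finset.sum_eq_zero fun ij hij => ?_
  have h : ij.1 + ij.2 = j := by
    simp only [Finset.mem_antidiagonal] at hij
    exact hij.2.2
  rcases lt_or_ge ij.1 d with h1 | h1
  · rw [hf _ h1, zero_mul]
  · rw [hg _ (by omega), mul_zero]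

lemma sum {ι : Type*} {s : Finset ι} {F : ι → K} (h : ∀ i ∈ s, VanishBelow d (F i)) :
    VanishBelow d (∑ i ∈ s, F i) := by
  classical
  induction s using Finset.induction_on with
  | empty => simpa using zero
  | insert a s ha ih =>
    rw [Finset.sum_insert ha]
    exact (h _ (by simp)).add (ih fun i hi => h i (by simp [hi]))

lemma const (z : ℂ) : VanishBelow 0 (Cc z) := fun j hj => by
  rw [Cc, HahnSeries.C_apply, HahnSeries.coeff_single_of_ne (by omega)]

lemma one : VanishBelow 0 (1 : K) := by
  have := const 1
  rwa [Cc, map_one] at this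

end VanishBelow

lemma memO1_iff {f : K} : memO1 f ↔ VanishBelow 1 f :=
  ⟨fun h j hj => h j (by omega), fun h j hj => h j (by omega)⟩

lemma Cc_zero : Cc 0 = 0 := map_zero HahnSeries.C

lemma Cc_one : Cc 1 = 1 := map_one HahnSeries.C

lemma Cc_add (x y : ℂ) : Cc (x + y) = Cc x + Cc y := map_add HahnSeries.C x y

lemma Cc_mul (x y : ℂ) : Cc (x * y) = Cc x * Cc y := map_mul HahnSeries.C x y

lemma Cc_neg (x : ℂ) : Cc (-x) = -Cc x := map_neg HahnSeries.C x

lemma Cc_inv (x : ℂ) : Cc x⁻¹ = (Cc x)⁻¹ := map_inv₀ HahnSeries.C x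

lemma Cc_sum {ι : Type*} (S : Finset ι) (F : ι → ℂ) : Cc (∑ i ∈ S, F i) = ∑ i ∈ S, Cc (F i) :=
  map_sum HahnSeries.C F S

lemma tK_ne_zero : tK ≠ 0 := by
  rw [tK]; exact HahnSeries.single_ne_zero one_ne_zero

lemma tK_inv : tK⁻¹ = HahnSeries.single (1 : ℤ) (1 : ℂ) := by
  rw [tK, HahnSeries.inv_single]; simp

lemma tK_zpow (m : ℤ) : tK ^ m = HahnSeries.single (-m) (1 : ℂ) := by
  have h := RatFunc.single_zpow (F := ℂ) (-m)
  rw [h, ← tK_inv, _root_.inv_zpow', neg_neg]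

lemma vanishBelow_zpow (m : ℤ) : VanishBelow (-m) (tK ^ m) := fun j hj => by
  rw [tK_zpow, HahnSeries.coeff_single_of_ne (by omega)]

lemma Cc_mul_zpow (z : ℂ) (m : ℤ) : Cc z * tK ^ m = HahnSeries.single (-m) z := by
  rw [tK_zpow, Cc, HahnSeries.C_apply, HahnSeries.single_mul_single]; simp

lemma vanishBelow_const_mul_inv (z : ℂ) : VanishBelow 1 (Cc z * tK⁻¹) := by
  have := (VanishBelow.const z).mul (vanishBelow_zpow (-1))
  simpa using this

lemma ne_zero_of_sub_one {d : K} (h : VanishBelow 1 (d - 1)) : d ≠ 0 := by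
  rintro rfl
  simpa using h 0 (by norm_num)

lemma vanishBelow_inv {d : K} (h : VanishBelow 1 (d - 1)) : VanishBelow 0 d⁻¹ := by
  have hd := ne_zero_of_sub_one h
  have h0 : d.coeff 0 = 1 := by
    have := h 0 (by norm_num)
    rw [HahnSeries.coeff_sub, HahnSeries.coeff_one, if_pos rfl] at this
    linear_combination this
  have h1 : d.order ≤ 0 := HahnSeries.order_le_of_coeff_ne_zero (by simp [h0])
  have h2 : d.order + d⁻¹.order = 0 := by
    rw [← HahnSeries.order_mul hd (inv_ne_zero hd), mul_inv_cancel₀ hd, HahnSeries.order_one]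
  exact fun j hj => HahnSeries.coeff_eq_zero_of_lt_order (by omega)

/-- Every Laurent series is a polynomial in `t` plus an element of `𝒪₁`. -/
lemma exists_memPoly_sub (f : K) : ∃ q : K, memPoly q ∧ VanishBelow 1 (f - q) := by
  classical
  refine ⟨⟨fun j => if j ≤ 0 then f.coeff j else 0, f.isPWO_support'.mono ?_⟩, ?_, ?_⟩
  · intro j hj
    simp only [Function.mem_support] at hj ⊢
    intro h
    simp [h] at hj
  · intro j hj
    simp [not_le.mpr hj]
  · intro j hj
    simp [show j ≤ 0 by omega]

lemma eq_zero_of_memPoly {f : K} (h : memPoly f) (h' : VanishBelow 1 f) : f = 0 := by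
  ext j
  rcases lt_or_ge 0 j with hj | hj
  · simpa using h j hj
  · simpa using h' j (by omega)

/-- `M` lies in the first congruence subgroup: `M - 1` has entries in `𝒪₁`. -/
def CongrOne {m : ℕ} (M : Matrix (Fin m) (Fin m) K) : Prop :=
  ∀ i j, VanishBelow 1 ((M - 1) i j)

section

variable {m : ℕ} {M N : Matrix (Fin m) (Fin m) K}

lemma CongrOne.one : CongrOne (1 : Matrix (Fin m) (Fin m) K) := fun i j => by
  simpa using VanishBelow.zero

lemma CongrOne.mul (hM : CongrOne M) (hN : CongrOne N) : CongrOne (M * N) := by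
  intro i j
  have h : M * N - 1 = (M - 1) * (N - 1) + (M - 1) + (N - 1) := by
    rw [Matrix.sub_mul, Matrix.mul_sub, Matrix.one_mul, Matrix.mul_one]; abel
  rw [h, Matrix.add_apply, Matrix.add_apply, Matrix.mul_apply]
  refine VanishBelow.add (.add (.sum fun l _ => ?_) (hM i j)) (hN i j)
  exact ((hM i l).mul (hN l j)).mono (by norm_num)

lemma CongrOne.transpose (hM : CongrOne M) : CongrOne Mᵀ := fun i j => by
  have h := hM j i
  simp only [Matrix.sub_apply, Matrix.transpose_apply, Matrix.one_apply, eq_comm (a := i)] at h ⊢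
  exact h

lemma memN1_iff : MemN1 M ↔ IsUpperUni M ∧ CongrOne M := by
  refine and_congr_right fun hM => ⟨fun h i j => ?_, fun h i j hij => ?_⟩
  · rcases eq_or_ne i j with rfl | hij
    · simpa [hM.1] using VanishBelow.zero
    · simpa [Matrix.one_apply_ne hij] using memO1_iff.mp (h i j hij)
  · simpa [Matrix.one_apply_ne hij] using memO1_iff.mpr (h i j)

lemma isLowerUni_iff : IsLowerUni M ↔ IsUpperUni Mᵀ :=
  ⟨fun h => ⟨h.1, fun i j => h.2 j i⟩, fun h => ⟨h.1, fun i j => h.2 j i⟩⟩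

lemma memN1neg_iff_transpose : MemN1neg M ↔ MemN1 Mᵀ :=
  and_congr isLowerUni_iff
    ⟨fun h i j hij => h j i hij.symm, fun h i j hij => h j i hij.symm⟩

lemma memN1neg_iff : MemN1neg M ↔ IsLowerUni M ∧ CongrOne M := by
  rw [memN1neg_iff_transpose, memN1_iff, isLowerUni_iff]
  exact and_congr_right fun _ => ⟨fun h => h.transpose, fun h => h.transpose⟩

lemma IsUpperUni.isUpperTriangular (hM : IsUpperUni M) : M.IsUpperTriangular :=
  fun i j hij => hM.2 i j hij

lemma IsUpperUni.one : IsUpperUni (1 : Matrix (Fin m) (Fin m) K) :=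
  ⟨fun i => by simp, fun i j hij => Matrix.one_apply_ne hij.ne'⟩

lemma upper_mul_diag (hM : ∀ i j, j < i → M i j = 0) (hN : ∀ i j, j < i → N i j = 0) (i : Fin m) :
    (M * N) i i = M i i * N i i := by
  rw [Matrix.mul_apply, Finset.sum_eq_single i _ (by simp)]
  intro l _ hl
  rcases lt_or_gt_of_ne hl with h | h
  · rw [hM _ _ h, zero_mul]
  · rw [hN _ _ h, mul_zero]

lemma upper_mul (hM : ∀ i j, j < i → M i j = 0) (hN : ∀ i j, j < i → N i j = 0) (i j : Fin m)
    (hij : j < i) : (M * N) i j = 0 := by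
  rw [Matrix.mul_apply]
  refine Finset.sum_eq_zero fun l _ => ?_
  rcases lt_or_ge l i with h | h
  · rw [hM _ _ h, zero_mul]
  · rw [hN _ _ (hij.trans_le h), mul_zero]

lemma IsUpperUni.mul (hM : IsUpperUni M) (hN : IsUpperUni N) : IsUpperUni (M * N) :=
  ⟨fun i => by rw [upper_mul_diag hM.2 hN.2, hM.1, hN.1, one_mul], upper_mul hM.2 hN.2⟩

lemma IsLowerUni.mul (hM : IsLowerUni M) (hN : IsLowerUni N) : IsLowerUni (M * N) := by
  rw [isLowerUni_iff] at *
  rw [Matrix.transpose_mul]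
  exact hN.mul hM

lemma IsUpperUni.det (hM : IsUpperUni M) : M.det = 1 := by
  rw [Matrix.det_of_isUpperTriangular hM.isUpperTriangular]
  exact Finset.prod_eq_one fun i _ => hM.1 i

lemma IsUpperUni.inv (hM : IsUpperUni M) : ∀ i j, j < i → M⁻¹ i j = 0 := by
  have : Invertible M := Matrix.invertibleOfIsUnitDet M (by simp [hM.det])
  exact fun i j hij => Matrix.blockTriangular_inv_of_blockTriangular hM.isUpperTriangular hij

/-- Uniqueness of the unipotent factor in a decomposition `N · T · N₋` over the field `K`. -/
lemma gauss_upper_unique {U V L L' : Matrix (Fin m) (Fin m) K} {D D' : Fin m → K}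
    (hU : IsUpperUni U) (hV : IsUpperUni V) (hL : IsLowerUni L) (hL' : IsLowerUni L')
    (hD : ∀ i, D i ≠ 0)
    (h : U * diagonal D * L = V * diagonal D' * L') : U = V := by
  have hVu : IsUnit V.det := by simp [hV.det]
  have hLt := isLowerUni_iff.mp hL
  have hLu : IsUnit L.det := by rw [← Matrix.det_transpose, hLt.det]; exact isUnit_one
  have key : V⁻¹ * U * diagonal D = diagonal D' * (L' * L⁻¹) := by
    have h2 : V⁻¹ * (U * diagonal D * L) * L⁻¹ = V⁻¹ * (V * diagonal D' * L') * L⁻¹ := by rw [h]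
    simp only [Matrix.mul_assoc, Matrix.mul_nonsing_inv _ hLu, Matrix.mul_one,
      Matrix.nonsing_inv_mul_cancel_left _ _ hVu] at h2 ⊢
    exact h2
  have hup := upper_mul hV.inv hU.2
  have hlow : ∀ i j, i < j → (L' * L⁻¹) i j = 0 := by
    intro i j hij
    have := upper_mul (M := L⁻¹ᵀ) (N := L'ᵀ)
      (by rw [Matrix.transpose_nonsing_inv]; exact hLt.inv) (isLowerUni_iff.mp hL').2 j i hij
    rwa [← Matrix.transpose_mul] at this
  have hVP : U = V * (V⁻¹ * U) := by rw [Matrix.mul_nonsing_inv_cancel_left _ _ hVu]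
  have hP : V⁻¹ * U = 1 := by
    refine Matrix.ext fun i j => ?_
    rcases lt_trichotomy i j with hij | rfl | hij
    · have h3 := congrFun (congrFun key i) j
      rw [Matrix.mul_diagonal, Matrix.diagonal_mul, hlow i j hij, mul_zero] at h3
      rw [Matrix.one_apply_ne hij.ne]
      exact (mul_eq_zero.mp h3).resolve_right (hD j)
    · have h3 := congrFun (congrFun hVP i) i
      rw [upper_mul_diag hV.2 hup, hU.1, hV.1, one_mul] at h3
      rw [← h3, Matrix.one_apply_eq]
    · rw [hup i j hij, Matrix.one_apply_ne hij.ne']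
  rw [hVP, hP, Matrix.mul_one]

/-- `N(K) = N[t] · N₁[[t⁻¹]]`, one row at a time. -/
lemma exists_poly_row {W : Matrix (Fin m) (Fin m) K} (hW : IsUpperUni W) (i : Fin m) (d : ℕ) :
    ∃ c : Fin m → K, c i = 1 ∧ (∀ j, j < i → c j = 0) ∧ (∀ j, memPoly (c j)) ∧
      ∀ j, i < j → (j : ℕ) < d → VanishBelow 1 ((c ᵥ* W) j) := by
  induction d with
  | zero =>
    refine ⟨Pi.single i 1, by simp, fun j hj => Pi.single_eq_of_ne hj.ne _, fun j l hl => ?_,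
      fun j _ h => absurd h (by omega)⟩
    rcases eq_or_ne j i with rfl | h
    · simp [HahnSeries.coeff_one, hl.ne']
    · simp [h]
  | succ d ih =>
    obtain ⟨c, h1, h2, h3, h4⟩ := ih
    by_cases hd : ∃ l : Fin m, (l : ℕ) = d ∧ i < l
    · obtain ⟨l, rfl, hl⟩ := hd
      obtain ⟨q, hq, hq'⟩ := exists_memPoly_sub ((c ᵥ* W) l)
      refine ⟨c - Pi.single l q, by simp [h1, hl.ne], fun j hj => ?_, fun j a ha => ?_,
        fun j hj hjl => ?_⟩
      · simp [h2 j hj, (hj.trans hl).ne]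
      · rcases eq_or_ne j l with rfl | h
        · simp [h3 j a ha, hq a ha]
        · simp [h, h3 j a ha]
      · rw [Matrix.sub_vecMul, Pi.sub_apply, Matrix.single_vecMul, Pi.smul_apply, smul_eq_mul,
          Matrix.row_apply]
        rcases eq_or_ne j l with rfl | h
        · rw [hW.1, mul_one]; exact hq'
        · have hlt : j < l := lt_of_le_of_ne (Fin.le_def.mpr (by omega)) h
          rw [hW.2 l j hlt, mul_zero, sub_zero]
          exact h4 j hj hlt
    · exact ⟨c, h1, h2, h3, fun j hj hjd => h4 j hj (by
        by_contra hlt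
        exact hd ⟨j, by omega, hj⟩)⟩

/-- `N(K) = N[t] · N₁[[t⁻¹]]`. -/
lemma exists_poly_mul_memN1 {W : Matrix (Fin m) (Fin m) K} (hW : IsUpperUni W) :
    ∃ a, MemNpoly a ∧ MemN1 (a * W) := by
  choose c h1 h2 h3 h4 using fun i => exists_poly_row hW i m
  have ha : IsUpperUni (Matrix.of c) := ⟨h1, h2⟩
  refine ⟨Matrix.of c, ⟨ha, h3⟩, ha.mul hW, fun i j hij => ?_⟩
  rcases lt_or_gt_of_ne hij with h | h
  · exact memO1_iff.mpr (h4 i j h j.2)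
  · rw [(ha.mul hW).2 i j h]
    exact memO1_iff.mpr .zero

lemma exists_mul_poly_memN1neg {W : Matrix (Fin m) (Fin m) K} (hW : IsLowerUni W) :
    ∃ a, MemNnegPoly a ∧ MemN1neg (W * a) := by
  obtain ⟨a, ha, h⟩ := exists_poly_mul_memN1 (isLowerUni_iff.mp hW)
  refine ⟨aᵀ, ⟨isLowerUni_iff.mpr ha.1, fun i j => ha.2 j i⟩, ?_⟩
  rw [memN1neg_iff_transpose, Matrix.transpose_mul, Matrix.transpose_transpose]
  exact h

end

section

variable {m : ℕ}

/-- The identity matrix with the vector `c` added to its column `p`. -/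
def addCol (p : Fin m) (c : Fin m → K) : Matrix (Fin m) (Fin m) K :=
  fun i j => (if i = j then 1 else 0) + if j = p then c i else 0

lemma addCol_mul_apply (p : Fin m) (c : Fin m → K) (Y : Matrix (Fin m) (Fin m) K) (i j : Fin m) :
    (addCol p c * Y) i j = Y i j + c i * Y p j := by
  simp [Matrix.mul_apply, addCol, add_mul, Finset.sum_add_distrib, ite_mul]

lemma mul_addCol_transpose_apply (p : Fin m) (r : Fin m → K) (Y : Matrix (Fin m) (Fin m) K)
    (i j : Fin m) : (Y * (addCol p r)ᵀ) i j = Y i j + Y i p * r j := by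
  simp [Matrix.mul_apply, addCol, mul_add, Finset.sum_add_distrib, mul_ite]

lemma memN1_addCol {p : Fin m} {c : Fin m → K} (hc : ∀ i, VanishBelow 1 (c i))
    (hc' : ∀ i, p ≤ i → c i = 0) : MemN1 (addCol p c) := by
  refine ⟨⟨fun i => ?_, fun i j hij => ?_⟩, fun i j hij => memO1_iff.mpr ?_⟩
  · rcases eq_or_ne i p with rfl | h
    · simp [addCol, hc' i le_rfl]
    · simp [addCol, h]
  · rcases eq_or_ne j p with rfl | h
    · simp [addCol, hc' i hij.le, hij.ne']
    · simp [addCol, h, hij.ne']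
  · rw [addCol, if_neg hij, zero_add]
    split_ifs
    exacts [hc i, .zero]

lemma MemN1.mul {M N : Matrix (Fin m) (Fin m) K} (hM : MemN1 M) (hN : MemN1 N) :
    MemN1 (M * N) := by
  rw [memN1_iff] at *
  exact ⟨hM.1.mul hN.1, hM.2.mul hN.2⟩

lemma MemN1neg.mul {M N : Matrix (Fin m) (Fin m) K} (hM : MemN1neg M) (hN : MemN1neg N) :
    MemN1neg (M * N) := by
  rw [memN1neg_iff] at *
  exact ⟨hM.1.mul hN.1, hM.2.mul hN.2⟩

lemma MemN1.one : MemN1 (1 : Matrix (Fin m) (Fin m) K) :=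
  memN1_iff.mpr ⟨.one, .one⟩

lemma MemN1neg.one : MemN1neg (1 : Matrix (Fin m) (Fin m) K) := by
  rw [memN1neg_iff_transpose, Matrix.transpose_one]
  exact .one

lemma exists_partial_gauss {M : Matrix (Fin m) (Fin m) K} (hM : CongrOne M) (d : ℕ) :
    ∃ u X l : Matrix (Fin m) (Fin m) K, MemN1 u ∧ MemN1neg l ∧ CongrOne X ∧ M = u * X * l ∧
      ∀ i j : Fin m, i ≠ j → (m ≤ i + d ∨ m ≤ j + d) → X i j = 0 := by
  induction d with
  | zero => exact ⟨1, M, 1, .one, .one, hM, by simp, fun i j _ h => absurd h (by omega)⟩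
  | succ d ih =>
    obtain ⟨u, X, l, hu, hl, hX, hMX, hz⟩ := ih
    rcases le_or_gt m d with hd | hd
    · exact ⟨u, X, l, hu, hl, hX, hMX, fun i j hij _ => hz i j hij (by omega)⟩
    obtain ⟨p, hp⟩ : ∃ p : Fin m, (p : ℕ) = m - 1 - d := ⟨⟨m - 1 - d, by omega⟩, rfl⟩
    have hXp : VanishBelow 1 (X p p - 1) := by simpa using hX p p
    have hX0 : X p p ≠ 0 := ne_zero_of_sub_one hXp
    have hoff : ∀ i j, i ≠ j → VanishBelow 1 (X i j) := fun i j hij => by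
      simpa [Matrix.one_apply_ne hij] using hX i j
    have hinv := vanishBelow_inv hXp
    set c : Fin m → K := fun i => if i = p then 0 else X i p * (X p p)⁻¹ with hc
    set r : Fin m → K := fun j => if j = p then 0 else X p j * (X p p)⁻¹ with hr
    have hc1 : ∀ i, VanishBelow 1 (c i) := fun i => by
      simp only [hc]
      split_ifs with h
      exacts [.zero, ((hoff i p h).mul hinv).mono (by norm_num)]
    have hr1 : ∀ i, VanishBelow 1 (r i) := fun i => by
      simp only [hr]
      split_ifs with h
      exacts [.zero, ((hoff p i (Ne.symm h)).mul hinv).mono (by norm_num)]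
    have hc2 : ∀ i, p ≤ i → c i = 0 := fun i hi => by
      simp only [hc]
      split_ifs with h
      · rfl
      · have : (p : ℕ) < i := lt_of_le_of_ne hi fun hpi => h (Fin.ext hpi.symm)
        rw [hz i p h (by omega), zero_mul]
    have hr2 : ∀ i, p ≤ i → r i = 0 := fun i hi => by
      simp only [hr]
      split_ifs with h
      · rfl
      · have : (p : ℕ) < i := lt_of_le_of_ne hi fun hpi => h (Fin.ext hpi.symm)
        rw [hz p i (Ne.symm h) (by omega), zero_mul]
    have hl' : MemN1neg (addCol p r)ᵀ := by
      rw [memN1neg_iff_transpose, Matrix.transpose_transpose]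
      exact memN1_addCol hr1 hr2
    let X' : Matrix (Fin m) (Fin m) K := fun i j =>
      if i = p then (if j = p then X p p else 0) else if j = p then 0 else
        X i j - X p p * c i * r j
    refine ⟨u * addCol p c, X', (addCol p r)ᵀ * l, hu.mul (memN1_addCol hc1 hc2), hl'.mul hl,
      fun i j => ?_, ?_, fun i j hij h => ?_⟩
    · rw [Matrix.sub_apply]
      by_cases hi : i = p <;> by_cases hj : j = p
      · subst hi; subst hj; simpa [X'] using hXp
      · subst hi; simpa [X', hj, Matrix.one_apply_ne (Ne.symm hj)] using VanishBelow.zero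
      · subst hj; simpa [X', hi, Matrix.one_apply_ne hi] using VanishBelow.zero
      · have h1 : X' i j - (1 : Matrix (Fin m) (Fin m) K) i j
            = (X - 1) i j - ((X p p - 1) * c i * r j + c i * r j) := by
          simp only [X', hi, hj, if_false, Matrix.sub_apply]; ring
        rw [h1]
        exact (hX i j).sub ((((hXp.mul (hc1 i)).mul (hr1 j)).mono (by norm_num)).add
          (((hc1 i).mul (hr1 j)).mono (by norm_num)))
    · rw [hMX]
      have : X = addCol p c * X' * (addCol p r)ᵀ := by
        refine Matrix.ext fun i j => ?_
        rw [mul_addCol_transpose_apply, addCol_mul_apply, addCol_mul_apply]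
        by_cases hi : i = p <;> by_cases hj : j = p
        · subst hi; subst hj; simp [X', hc, hr]
        · subst hi; simp [X', hj, hc, hr]; field_simp
        · subst hj; simp [X', hi, hc, hr]; field_simp
        · simp [X', hi, hj]; ring
      conv_lhs => rw [this]
      simp only [Matrix.mul_assoc]
    · by_cases hi : i = p <;> by_cases hj : j = p
      · exact absurd (hi.trans hj.symm) hij
      · simp [X', hi, hj]
      · simp [X', hi, hj]
      · have hi' : (i : ℕ) ≠ p := fun h => hi (Fin.ext h)
        have hj' : (j : ℕ) ≠ p := fun h => hj (Fin.ext h)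
        simp only [X', hi, hj, if_false]
        rw [hz i j hij (by omega)]
        rcases h with h | h
        · rw [hc2 i (Fin.le_def.mpr (by omega))]; ring
        · rw [hr2 j (Fin.le_def.mpr (by omega))]; ring

/-- The first congruence subgroup is `N₁[[t⁻¹]] · T₁[[t⁻¹]] · N₋,₁[[t⁻¹]]`. -/
lemma exists_gauss_of_congrOne {M : Matrix (Fin m) (Fin m) K} (hM : CongrOne M) :
    ∃ u h l : Matrix (Fin m) (Fin m) K, MemN1 u ∧ MemT1 h ∧ MemN1neg l ∧ M = u * h * l := by
  obtain ⟨u, X, l, hu, hl, hX, hMX, hz⟩ := exists_partial_gauss hM m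
  exact ⟨u, X, l, hu, ⟨fun i j hij => hz i j hij (by omega), fun i => memO1_iff.mpr (by
    simpa using hX i i)⟩, hl, hMX⟩

lemma MemT1.eq_diagonal {h : Matrix (Fin m) (Fin m) K} (hh : MemT1 h) :
    h = diagonal fun i => h i i := by
  refine Matrix.ext fun i j => ?_
  rcases eq_or_ne i j with rfl | hij
  · simp
  · rw [hh.1 i j hij, diagonal_apply_ne _ hij]

lemma MemT1.congrOne {h : Matrix (Fin m) (Fin m) K} (hh : MemT1 h) : CongrOne h := fun i j => by
  rcases eq_or_ne i j with rfl | hij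
  · simpa using memO1_iff.mp (hh.2 i)
  · simpa [hh.1 i j hij, Matrix.one_apply_ne hij] using VanishBelow.zero

lemma MemT1.mul_tPow {h : Matrix (Fin m) (Fin m) K} (hh : MemT1 h) (ν : Fin m → ℤ) :
    h * tPow ν = diagonal fun i => h i i * tK ^ ν i := by
  conv_lhs => rw [hh.eq_diagonal]
  rw [tPow, diagonal_mul_diagonal]

lemma MemT1.mul_tPow_ne_zero {h : Matrix (Fin m) (Fin m) K} (hh : MemT1 h) (ν : Fin m → ℤ)
    (i : Fin m) : h i i * tK ^ ν i ≠ 0 :=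
  mul_ne_zero (ne_zero_of_sub_one (memO1_iff.mp (hh.2 i))) (zpow_ne_zero _ tK_ne_zero)

lemma tPow_mul_tPow (ν ν' : Fin m → ℤ) : tPow ν * tPow ν' = tPow (ν + ν') := by
  rw [tPow, tPow, diagonal_mul_diagonal, tPow]
  congr 1
  exact funext fun i => (zpow_add₀ tK_ne_zero _ _).symm

lemma tPow_zero : tPow (0 : Fin m → ℤ) = 1 := by
  rw [tPow, ← diagonal_one]
  simp

/-- `t^{-ν} M t^{ν}`, entrywise. -/
lemma tPow_conj_apply (ν : Fin m → ℤ) (M : Matrix (Fin m) (Fin m) K) (i j : Fin m) :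
    (tPow (-ν) * M * tPow ν) i j = tK ^ (-ν i) * M i j * tK ^ ν j := by
  rw [tPow, tPow, mul_diagonal, diagonal_mul, Pi.neg_apply]

lemma IsUpperUni.conj {M : Matrix (Fin m) (Fin m) K} (hM : IsUpperUni M) (ν : Fin m → ℤ) :
    IsUpperUni (tPow (-ν) * M * tPow ν) := by
  refine ⟨fun i => ?_, fun i j hij => ?_⟩
  · rw [tPow_conj_apply, hM.1, mul_one, ← zpow_add₀ tK_ne_zero, neg_add_cancel, zpow_zero]
  · rw [tPow_conj_apply, hM.2 i j hij, mul_zero, zero_mul]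

lemma IsLowerUni.conj {M : Matrix (Fin m) (Fin m) K} (hM : IsLowerUni M) (ν : Fin m → ℤ) :
    IsLowerUni (tPow (-ν) * M * tPow ν) := by
  refine ⟨fun i => ?_, fun i j hij => ?_⟩
  · rw [tPow_conj_apply, hM.1, mul_one, ← zpow_add₀ tK_ne_zero, neg_add_cancel, zpow_zero]
  · rw [tPow_conj_apply, hM.2 i j hij, mul_zero, zero_mul]

/-- Elements of `N(K) · T₁[[t⁻¹]] · t^μ · N₋(K)` have an image under `π`. -/
lemma exists_isPiOf {μ : Fin m → ℤ} {W h L : Matrix (Fin m) (Fin m) K} (hW : IsUpperUni W)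
    (hh : MemT1 h) (hL : IsLowerUni L) : ∃ z, IsPiOf μ (W * (h * tPow μ) * L) z := by
  obtain ⟨a, ha, haW⟩ := exists_poly_mul_memN1 hW
  obtain ⟨b, hb, hbL⟩ := exists_mul_poly_memN1neg hL
  exact ⟨a * (W * (h * tPow μ) * L) * b,
    ⟨a * W, h, L * b, haW, hh, hbL, by simp only [Matrix.mul_assoc]⟩, a, b, ha, hb, rfl⟩

lemma IsGauss.upper_eq {μ : Fin m → ℤ} {W h L a b z U h' L' : Matrix (Fin m) (Fin m) K}
    (hW : IsUpperUni W) (hh : MemT1 h) (hL : IsLowerUni L) (ha : IsUpperUni a) (hb : IsLowerUni b)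
    (hz : z = a * (W * (h * tPow μ) * L) * b) (hg : IsGauss μ z U h' L') : U = a * W := by
  obtain ⟨hU, hh', hL', hz'⟩ := hg
  refine gauss_upper_unique hU.1 (ha.mul hW) hL'.1 (hL.mul hb) (hh'.mul_tPow_ne_zero μ)
    (D' := fun i => h i i * tK ^ μ i) ?_
  rw [← hh'.mul_tPow, ← hh.mul_tPow, ← Matrix.mul_assoc U, ← hz', hz]
  simp only [Matrix.mul_assoc]

/-- Left multiplication by `N[t]` does not change a block of an upper unitriangular matrix
if before and after the off-diagonal entries of the block lie in `𝒪₁`. -/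
lemma block_eq_of_poly_mul {W U a : Matrix (Fin m) (Fin m) K} (hW : IsUpperUni W)
    (ha : MemNpoly a) (h : U = a * W) {s e : ℕ}
    (hW1 : ∀ i j : Fin m, s ≤ i → i < j → (j : ℕ) ≤ e → VanishBelow 1 (W i j))
    (hU1 : ∀ i j : Fin m, s ≤ i → i < j → (j : ℕ) ≤ e → VanishBelow 1 (U i j))
    (i j : Fin m) (hi : s ≤ i) (hij : i < j) (hj : (j : ℕ) ≤ e) : U i j = W i j := by
  have hexp : ∀ j : Fin m, i < j → (∀ l, i < l → l < j → a i l = 0) →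
      U i j = a i j + W i j := by
    intro j hij hlt
    rw [h, Matrix.mul_apply, Finset.sum_eq_add i j hij.ne]
    · rw [ha.1.1, hW.1, one_mul, mul_one, add_comm]
    · intro l _ hl
      rcases lt_or_gt_of_ne hl.1 with h1 | h1
      · rw [ha.1.2 i l h1, zero_mul]
      · rcases lt_or_gt_of_ne hl.2 with h2 | h2
        · rw [hlt l h1 h2, zero_mul]
        · rw [hW.2 l j h2, mul_zero]
    · simp
    · simp
  have hzero : ∀ j : Fin m, i < j → (j : ℕ) ≤ e → a i j = 0 := by
    intro j
    induction j using WellFoundedLT.induction with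
    | _ j ih =>
      intro hij hj
      have h1 := hexp j hij fun l h1 h2 => ih l h2 h1 (by omega)
      refine eq_zero_of_memPoly (ha.2 i j) ?_
      rw [show a i j = U i j - W i j by rw [h1]; ring]
      exact (hU1 i j hi hij hj).sub (hW1 i j hi hij hj)
  rw [hexp j hij fun l h1 h2 => hzero l h1 (by omega), hzero j hij hj, zero_add]

end

section

variable {n s q : ℕ}

/-- The coefficients `b` (or `g`) of `y(p,e,b,g)`, indexed by the row (or column) of the
`n × n` matrix in which they appear, and extended by zero. -/
def extendMid (s q : ℕ) (b : Fin q → ℂ) (i : ℕ) : ℂ :=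
  if h : s < i ∧ i < s + q + 1 then b ⟨s + q - i, by omega⟩ else 0

lemma extendMid_of_not (b : Fin q → ℂ) {i : ℕ} (h : ¬(s < i ∧ i < s + q + 1)) :
    extendMid s q b i = 0 := dif_neg h

lemma sum_extendMid (hn : s + q + 1 < n) (b g : Fin q → ℂ) :
    ∑ l : Fin n, extendMid s q g l * extendMid s q b l = ∑ i, b i * g i := by
  symm
  refine Finset.sum_of_injOn (fun i : Fin q => (⟨s + q - i, by omega⟩ : Fin n)) ?_ (by simp) ?_ ?_
  · intro i _ j _ hij
    have : s + q - (i : ℕ) = s + q - j := congrArg Fin.val hij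
    exact Fin.ext (by omega)
  · intro l _ hl
    rw [extendMid, dif_neg, zero_mul]
    rintro ⟨h1, h2⟩
    exact hl ⟨⟨s + q - l, by omega⟩, by simp, Fin.ext (by simp; omega)⟩
  · intro i _
    have h : s < s + q - (i : ℕ) ∧ s + q - (i : ℕ) < s + q + 1 := by omega
    have h' : s + q - (s + q - (i : ℕ)) = i := by omega
    simp only [extendMid, dif_pos h, h', Fin.eta]
    ring

/-- The `N₁[[t⁻¹]]`-factor of `τ_α(y(p,e,b,g))`, up to terms that affect neither `Φ_α` nor `ζ_α`. -/
def leadUpper (n s q : ℕ) (p e : ℂ) (b g : Fin q → ℂ) : Matrix (Fin n) (Fin n) K :=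
  fun i j => (if i = j then 1 else 0) +
    ((if (i : ℕ) = s then
      ((if (j : ℕ) = s + q + 1 then
        Cc e * tK⁻¹ + Cc (e * (p + ∑ l, b l * g l)) * tK⁻¹ * tK⁻¹ else 0) +
        Cc (e * extendMid s q g j) * tK⁻¹) else 0) +
      if (j : ℕ) = s + q + 1 then Cc (extendMid s q b i) * tK⁻¹ else 0)

/-- The column of the rank one matrix `leadCongr - 1`. -/
def leadCol (s q : ℕ) (p e : ℂ) (b : Fin q → ℂ) (i : ℕ) : ℂ :=
  if i = s then e * p else if i = s + q + 1 then -1 else extendMid s q b i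

/-- The row of the rank one matrix `leadCongr - 1`. -/
def leadRow (s q : ℕ) (p e : ℂ) (b g : Fin q → ℂ) (j : ℕ) : ℂ :=
  if j = s then e⁻¹ else if j = s + q + 1 then p + ∑ l, b l * g l else extendMid s q g j

/-- The matrix `M ∈ 1 + t⁻¹ Mat(ℂ)` with `τ_α(y(p,e,b,g)) = leadUpper · t^{-α} · M`. -/
def leadCongr (n s q : ℕ) (p e : ℂ) (b g : Fin q → ℂ) : Matrix (Fin n) (Fin n) K :=
  fun i j => (if i = j then 1 else 0) + Cc (leadCol s q p e b i) * (Cc (leadRow s q p e b g j) * tK⁻¹)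

lemma congrOne_leadCongr (p e : ℂ) (b g : Fin q → ℂ) : CongrOne (leadCongr n s q p e b g) := by
  intro i j
  rw [Matrix.sub_apply, Matrix.one_apply, leadCongr, add_sub_cancel_left]
  exact ((VanishBelow.const _).mul (vanishBelow_const_mul_inv _)).mono (by norm_num)

lemma sum_col_row_mul {F : Type*} [CommRing F] {P : Prop} [Decidable P] {r : ℕ} (i R : Fin n)
    (hR : (R : ℕ) = r) (X Y : F) (c w : Fin n → F) :
    ∑ l, ((if i = l then 1 else 0) + ((if P then ((if (l : ℕ) = r then X else 0) + c l) else 0) +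
      if (l : ℕ) = r then Y else 0)) * w l
      = w i + ((if P then X * w R + ∑ l, c l * w l else 0) + Y * w R) := by
  have h : ∀ l : Fin n, (l : ℕ) = r ↔ l = R := fun l => by rw [Fin.ext_iff, hR]
  by_cases hP : P <;> simp [hP, h, add_mul, Finset.sum_add_distrib]

lemma row_identity {F : Type*} [Field F] {t : F} (ht : t ≠ 0) (e p S : F) :
    t⁻¹ * (e * p) + ((e * t⁻¹ + e * (p + S) * t⁻¹ * t⁻¹) * -t + e * t⁻¹ * S + 0 * t⁻¹ * -t)
      = -e := by
  field_simp
  ring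

lemma mid_identity {F : Type*} [Field F] {t : F} (ht : t ≠ 0) (x : F) :
    x + (0 + x * t⁻¹ * -t) = 0 := by
  field_simp
  ring

lemma leadUpper_mulVec (hn : s + q + 1 < n) (p e : ℂ) (b g : Fin q → ℂ) (i : Fin n) :
    ∑ l, leadUpper n s q p e b g i l *
        (tK ^ (-alphaCo n (s + 1) (s + q + 1)) l * Cc (leadCol s q p e b l))
      = if (i : ℕ) = s then - Cc e else if (i : ℕ) = s + q + 1 then -tK else 0 := by
  have hT := tK_ne_zero
  set w : Fin n → K := fun l =>
    tK ^ (-alphaCo n (s + 1) (s + q + 1)) l * Cc (leadCol s q p e b l) with hw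
  let R : Fin n := ⟨s + q + 1, hn⟩
  have hR : ∀ l : Fin n, (l : ℕ) = s + q + 1 ↔ l = R := fun l => by simp [R, Fin.ext_iff]
  have hwR : w R = -tK := by
    have : s + q + 1 ≠ s := by omega
    simp only [hw, R, alphaCo, leadCol, this, Pi.neg_apply, if_true, if_false, Nat.add_sub_cancel,
      Cc_neg, Cc_one, neg_neg, zpow_one]
    ring
  have hwg : ∀ l : Fin n, Cc (extendMid s q g l) * w l
      = Cc (extendMid s q g l * extendMid s q b l) := by
    intro l
    by_cases h : s < (l : ℕ) ∧ (l : ℕ) < s + q + 1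
    · have h1 : (l : ℕ) ≠ s := by omega
      have h2 : (l : ℕ) ≠ s + q + 1 := by omega
      simp [hw, alphaCo, leadCol, h1, h2, Cc_mul]
    · rw [extendMid_of_not _ h, zero_mul, Cc_zero, zero_mul]
  have hsum : ∑ l, Cc (extendMid s q g (l : Fin n)) * w l = Cc (∑ i, b i * g i) := by
    rw [Finset.sum_congr rfl fun l _ => hwg l, ← sum_extendMid hn b g, Cc_sum]
  have hmain : ∑ l, leadUpper n s q p e b g i l * w l = w i +
      ((if (i : ℕ) = s then
        (Cc e * tK⁻¹ + Cc (e * (p + ∑ l, b l * g l)) * tK⁻¹ * tK⁻¹) * w R +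
          Cc e * tK⁻¹ * Cc (∑ l, b l * g l) else 0) +
        Cc (extendMid s q b i) * tK⁻¹ * w R) := by
    have h3 : ∑ l : Fin n, Cc (e * extendMid s q g l) * tK⁻¹ * w l
        = Cc e * tK⁻¹ * Cc (∑ l, b l * g l) := by
      rw [← hsum, Finset.mul_sum]
      refine Finset.sum_congr rfl fun l _ => ?_
      rw [Cc_mul]
      generalize w l = z
      ring
    rw [← h3]
    exact sum_col_row_mul i R rfl _ _ _ w
  rw [hmain, hwR]
  by_cases hi : (i : ℕ) = s
  · have hwi : w i = tK⁻¹ * Cc (e * p) := by simp [hw, hi, alphaCo, leadCol]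
    have hb : extendMid s q b i = 0 := by simp [extendMid, hi]
    rw [hwi, hb, if_pos hi, if_pos hi, Cc_mul, Cc_mul, Cc_add, Cc_zero]
    exact row_identity hT _ _ _
  · by_cases hi' : (i : ℕ) = s + q + 1
    · have hb : extendMid s q b i = 0 := by simp [extendMid, hi']
      rw [hb, if_neg hi, if_neg hi, if_pos hi', (hR i).mp hi', hwR, Cc_zero]
      ring
    · have hwi : w i = Cc (extendMid s q b i) := by simp [hw, hi, hi', alphaCo, leadCol]
      rw [hwi, if_neg hi, if_neg hi, if_neg hi']
      exact mid_identity hT _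

lemma mul_leadCongr_apply (A : Matrix (Fin n) (Fin n) K) (ν : Fin n → ℤ) (p e : ℂ)
    (b g : Fin q → ℂ) (i j : Fin n) :
    (A * tPow ν * leadCongr n s q p e b g) i j = A i j * tK ^ ν j +
      (∑ l, A i l * (tK ^ ν l * Cc (leadCol s q p e b l))) *
        (Cc (leadRow s q p e b g j) * tK⁻¹) := by
  rw [Matrix.mul_apply, Finset.sum_mul]
  simp only [tPow, mul_diagonal, leadCongr, mul_add, Finset.sum_add_distrib]
  congr 1
  · simp
  · exact Finset.sum_congr rfl fun l _ => by ring

lemma blockEmbed_ymat_apply (p e : ℂ) (b g : Fin q → ℂ) (i j : Fin n) :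
    blockEmbed n (s + 1) (q + 1) (ymat (q + 1) p e b g) i j =
      if (i : ℕ) = s then (if (j : ℕ) = s + q + 1 then Cc e else 0)
      else if (i : ℕ) = s + q + 1 then
        (if (j : ℕ) = s then Cc (-e⁻¹)
        else if (j : ℕ) = s + q + 1 then tK - Cc (p + ∑ l, b l * g l)
        else Cc (-extendMid s q g j))
      else (if i = j then 1 else if (j : ℕ) = s + q + 1 then Cc (extendMid s q b i) else 0) := by
  have hij : i = j ↔ (i : ℕ) = j := Fin.ext_iff
  by_cases h : s ≤ (i : ℕ) ∧ (i : ℕ) ≤ s + (q + 1) ∧ s ≤ (j : ℕ) ∧ (j : ℕ) ≤ s + (q + 1)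
  · have h0 : (i : ℕ) - s = 0 ↔ (i : ℕ) = s := by omega
    have h1 : (i : ℕ) - s = q + 1 ↔ (i : ℕ) = s + q + 1 := by omega
    have h2 : (j : ℕ) - s = 0 ↔ (j : ℕ) = s := by omega
    have h3 : (j : ℕ) - s = q + 1 ↔ (j : ℕ) = s + q + 1 := by omega
    have h4 : (j : ℕ) - s = i - s ↔ i = j := by rw [hij]; omega
    simp only [blockEmbed, Nat.add_sub_cancel, dif_pos h, ymat, h0, h1, h2, h3, h4]
    split_ifs with c1 c2 c3 c4 c5 c6 c7 <;> try rfl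
    · rw [extendMid, dif_pos (by omega)]
      exact congrArg (fun x => Cc (-g x))
        (Fin.ext (show q + 1 - ((j : ℕ) - s) - 1 = s + q - j by omega))
    · rw [extendMid, dif_pos (by omega)]
      exact congrArg (fun x => Cc (b x))
        (Fin.ext (show q + 1 - ((i : ℕ) - s) - 1 = s + q - i by omega))
  · rw [blockEmbed, dif_neg (by simpa using h)]
    by_cases c1 : (i : ℕ) = s
    · have hj : ¬(j : ℕ) = s + q + 1 := by omega
      have hne : i ≠ j := by rw [Ne, hij]; omega
      simp only [c1, hj, hne, if_true, if_false]
    · rw [if_neg c1]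
      by_cases c2 : (i : ℕ) = s + q + 1
      · have hj : ¬(j : ℕ) = s + q + 1 := by omega
        have hj' : ¬(j : ℕ) = s := by omega
        have hne : i ≠ j := by rw [Ne, hij]; omega
        simp only [c2, hj, hj', hne, if_true, if_false,
          extendMid_of_not (s := s) (q := q) g (i := j) (by omega), neg_zero, Cc_zero]
      · rw [if_neg c2]
        split_ifs with c3 c4
        · rfl
        · rw [extendMid_of_not b (by omega), Cc_zero]
        · rfl

set_option linter.unusedSimpArgs false in
lemma blockEmbed_ymat_eq (hn : s + q + 1 < n) {p e : ℂ} (he : e ≠ 0) (b g : Fin q → ℂ) :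
    blockEmbed n (s + 1) (q + 1) (ymat (q + 1) p e b g) =
      leadUpper n s q p e b g * tPow (-alphaCo n (s + 1) (s + q + 1)) *
        leadCongr n s q p e b g := by
  have hT := tK_ne_zero
  have hCe : Cc e ≠ 0 := by
    rw [Cc, HahnSeries.C_apply]; exact HahnSeries.single_ne_zero he
  refine Matrix.ext fun i j => ?_
  rw [mul_leadCongr_apply, leadUpper_mulVec hn, blockEmbed_ymat_apply, leadUpper, leadRow,
    Pi.neg_apply, alphaCo, Nat.add_sub_cancel]
  have hne : s + q + 1 ≠ s := by omega
  have hgs : extendMid s q g s = 0 := extendMid_of_not _ (by omega)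
  have hgr : extendMid s q g (s + q + 1) = 0 := extendMid_of_not _ (by omega)
  have hbs : extendMid s q b s = 0 := extendMid_of_not _ (by omega)
  have hbr : extendMid s q b (s + q + 1) = 0 := extendMid_of_not _ (by omega)
  by_cases hi : (i : ℕ) = s
  · by_cases hj : (j : ℕ) = s
    · have hij : i = j := Fin.ext (by omega)
      simp only [hi, hj, hij, hne.symm, if_true, if_false, hgs]
      simp only [Cc_mul, Cc_zero, Cc_inv, Cc_neg, neg_neg, neg_zero, zpow_one, _root_.zpow_neg,
        zpow_zero, mul_zero, zero_mul, zero_add, add_zero, mul_one, one_mul, inv_one]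
      try (field_simp; try ring)
    · have hij : i ≠ j := fun h => hj (h ▸ hi)
      by_cases hj' : (j : ℕ) = s + q + 1
      · simp only [hi, hj, hj', hij, hne, if_true, if_false, hgr, hbs]
        simp only [Cc_mul, Cc_zero, Cc_inv, Cc_neg, neg_neg, neg_zero, zpow_one, _root_.zpow_neg,
          zpow_zero, mul_zero, zero_mul, zero_add, add_zero, mul_one, one_mul, inv_one]
        try (field_simp; try ring)
      · simp only [hi, hj, hj', hij, if_true, if_false, hbs]
        simp only [Cc_mul, Cc_zero, Cc_inv, Cc_neg, neg_neg, neg_zero, zpow_one, _root_.zpow_neg,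
          zpow_zero, mul_zero, zero_mul, zero_add, add_zero, mul_one, one_mul, inv_one]
        try (field_simp; try ring)
  · by_cases hi' : (i : ℕ) = s + q + 1
    · by_cases hj : (j : ℕ) = s
      · have hij : i ≠ j := fun h => hi (h ▸ hj)
        simp only [hi', hj, hij, hne, hne.symm, if_true, if_false]
        simp only [Cc_mul, Cc_zero, Cc_inv, Cc_neg, neg_neg, neg_zero, zpow_one, _root_.zpow_neg,
          zpow_zero, mul_zero, zero_mul, zero_add, add_zero, mul_one, one_mul, inv_one]
        try (field_simp; try ring)
      · by_cases hj' : (j : ℕ) = s + q + 1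
        · have hij : i = j := Fin.ext (by omega)
          simp only [hi', hj', hij, hne, if_true, if_false, hbr]
          simp only [Cc_mul, Cc_zero, Cc_inv, Cc_neg, neg_neg, neg_zero, zpow_one, _root_.zpow_neg,
            zpow_zero, mul_zero, zero_mul, zero_add, add_zero, mul_one, one_mul, inv_one]
          try (field_simp; try ring)
        · have hij : i ≠ j := fun h => hj' (h ▸ hi')
          simp only [hi', hj, hj', hij, hne, if_true, if_false]
          simp only [Cc_mul, Cc_zero, Cc_inv, Cc_neg, neg_neg, neg_zero, zpow_one, _root_.zpow_neg,
            zpow_zero, mul_zero, zero_mul, zero_add, add_zero, mul_one, one_mul, inv_one]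
          try (field_simp; try ring)
    · by_cases hij : i = j
      · subst hij
        simp only [hi, hi', if_true, if_false]
        simp only [Cc_mul, Cc_zero, Cc_inv, Cc_neg, neg_neg, neg_zero, zpow_one, _root_.zpow_neg,
          zpow_zero, mul_zero, zero_mul, zero_add, add_zero, mul_one, one_mul, inv_one]
      · by_cases hj' : (j : ℕ) = s + q + 1
        · simp only [hi, hi', hj', hij, hne, if_true, if_false]
          simp only [Cc_mul, Cc_zero, Cc_inv, Cc_neg, neg_neg, neg_zero, zpow_one, _root_.zpow_neg,
            zpow_zero, mul_zero, zero_mul, zero_add, add_zero, mul_one, one_mul, inv_one]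
          try (field_simp; try ring)
        · simp only [hi, hi', hj', hij, if_false]
          simp only [Cc_mul, Cc_zero, Cc_inv, Cc_neg, neg_neg, neg_zero, zpow_one, _root_.zpow_neg,
            zpow_zero, mul_zero, zero_mul, zero_add, add_zero, mul_one, one_mul, inv_one]

lemma isUpperUni_leadUpper (p e : ℂ) (b g : Fin q → ℂ) :
    IsUpperUni (leadUpper n s q p e b g) := by
  refine ⟨fun i => ?_, fun i j hij => ?_⟩
  · rw [leadUpper, if_pos rfl]
    by_cases hi : (i : ℕ) = s + q + 1
    · rw [if_neg (by omega), extendMid_of_not b (by omega)]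
      simp [Cc_zero]
    · rw [if_neg hi, if_neg hi]
      by_cases hi' : (i : ℕ) = s
      · rw [extendMid_of_not g (by omega)]
        simp [Cc_zero]
      · simp [hi']
  · have hlt : (j : ℕ) < i := hij
    rw [leadUpper, if_neg hij.ne']
    by_cases hj : (j : ℕ) = s + q + 1
    · rw [if_neg (by omega), extendMid_of_not b (by omega)]
      simp [Cc_zero]
    · rw [if_neg hj, if_neg hj]
      by_cases hi' : (i : ℕ) = s
      · rw [extendMid_of_not g (by omega)]
        simp [Cc_zero]
      · simp [hi']

lemma congrOne_leadUpper (p e : ℂ) (b g : Fin q → ℂ) :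
    CongrOne (leadUpper n s q p e b g) := by
  intro i j
  rw [Matrix.sub_apply, Matrix.one_apply, leadUpper, add_sub_cancel_left]
  have hinv : VanishBelow 1 (tK⁻¹) := by simpa using vanishBelow_zpow (-1)
  refine .add ?_ ?_
  · split_ifs
    · exact .add (.add (vanishBelow_const_mul_inv _)
        (((vanishBelow_const_mul_inv _).mul hinv).mono (by norm_num))) (vanishBelow_const_mul_inv _)
    · rw [zero_add]; exact vanishBelow_const_mul_inv _
    · exact .zero
  · split_ifs
    exacts [vanishBelow_const_mul_inv _, .zero]

end

section

variable {n s q : ℕ}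

lemma tPow_commute {m : ℕ} {h : Matrix (Fin m) (Fin m) K} (hh : MemT1 h) (ν : Fin m → ℤ) :
    h * tPow ν = tPow ν * h := by
  rw [hh.eq_diagonal, tPow, Matrix.diagonal_mul_diagonal, Matrix.diagonal_mul_diagonal]
  simp only [mul_comm]

lemma alphaCo_bounds (s q : ℕ) (i : Fin n) :
    ((i : ℕ) ≤ s + q → 0 ≤ alphaCo n (s + 1) (s + q + 1) i) ∧
    (s < (i : ℕ) → alphaCo n (s + 1) (s + q + 1) i ≤ 0) ∧
    alphaCo n (s + 1) (s + q + 1) i ≤ 1 := by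
  refine ⟨fun h => ?_, fun h => ?_, ?_⟩ <;> simp only [alphaCo] <;> split_ifs <;> omega

/-- On the block `{s,…,s+q+1}`, right multiplication by `t^{-α} u t^α` with `u ∈ N₁[[t⁻¹]]`
changes an element of `N₁[[t⁻¹]]` only in high order. -/
lemma vanishBelow_mul_conj_sub {A u : Matrix (Fin n) (Fin n) K} (hA : IsUpperUni A)
    (hA1 : CongrOne A) (hu : MemN1 u) {i j : Fin n} (hi : s ≤ i) (hij : i < j)
    (hj : (j : ℕ) ≤ s + q + 1) :
    VanishBelow (1 + alphaCo n (s + 1) (s + q + 1) i - alphaCo n (s + 1) (s + q + 1) j)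
      ((A * (tPow (-alphaCo n (s + 1) (s + q + 1)) * u *
        tPow (alphaCo n (s + 1) (s + q + 1)))) i j - A i j) := by
  set α := alphaCo n (s + 1) (s + q + 1) with hα
  set v := tPow (-α) * u * tPow α with hv
  have hvU : IsUpperUni v := by simpa using hu.1.conj α
  have hvij : ∀ l, l < j → VanishBelow (1 + α l - α j) (v l j) := by
    intro l hl
    have h1 : VanishBelow 1 (u l j) := by
      have := (memN1_iff.1 hu).2 l j
      rwa [Matrix.sub_apply, Matrix.one_apply_ne hl.ne, sub_zero] at this
    rw [hv, tPow_conj_apply]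
    exact (((vanishBelow_zpow _).mul h1).mul (vanishBelow_zpow _)).mono (by omega)
  have hsum : (A * v) i j - A i j = ∑ l, A i l * (v - 1) l j := by
    rw [← Matrix.mul_apply, Matrix.mul_sub, Matrix.mul_one, Matrix.sub_apply]
  rw [hsum]
  refine VanishBelow.sum fun l _ => ?_
  rw [Matrix.sub_apply]
  rcases lt_trichotomy l j with hl | rfl | hl
  · rw [Matrix.one_apply_ne hl.ne, sub_zero]
    rcases lt_trichotomy l i with hli | rfl | hli
    · rw [hA.2 i l hli, zero_mul]; exact .zero
    · rw [hA.1, one_mul]; exact hvij l hl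
    · have h1 : VanishBelow 1 (A i l) := by
        have := hA1 i l
        rwa [Matrix.sub_apply, Matrix.one_apply_ne hli.ne, sub_zero] at this
      have h2 := (alphaCo_bounds s q l).1 (by omega)
      have h3 := (alphaCo_bounds s q i).2.2
      rw [← hα] at h2 h3
      exact (h1.mul (hvij l hl)).mono (by omega)
  · rw [hvU.1, Matrix.one_apply_eq, sub_self, mul_zero]; exact .zero
  · rw [hvU.2 l j hl, Matrix.one_apply_ne hl.ne', sub_zero, mul_zero]; exact .zero

/-- Factorization of `y₁ y₂` whose upper unitriangular factor is explicit up to an element of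
`N₁[[t⁻¹]]` conjugated by `t^α`. -/
lemma exists_factor_mul (hn : s + q + 1 < n) {p e : ℂ} (he : e ≠ 0) (b g : Fin q → ℂ)
    {μ : Fin n → ℤ} {y₂ : Matrix (Fin n) (Fin n) K}
    (hy₂ : y₂ ∈ GrSlice (addAlpha n (s + 1) (s + q + 1) μ)) :
    ∃ u h L, MemN1 u ∧ MemT1 h ∧ IsLowerUni L ∧
      blockEmbed n (s + 1) (q + 1) (ymat (q + 1) p e b g) * y₂ =
        leadUpper n s q p e b g * (tPow (-alphaCo n (s + 1) (s + q + 1)) * u *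
          tPow (alphaCo n (s + 1) (s + q + 1))) * (h * tPow μ) * L := by
  obtain ⟨u₂, h₂, l₂, hu₂, hh₂, hl₂, rfl⟩ := hy₂
  obtain ⟨u, h, l, hu, hh, hl, hM⟩ := exists_gauss_of_congrOne
    (((congrOne_leadCongr (n := n) (s := s) p e b g).mul (memN1_iff.1 hu₂).2).mul hh₂.congrOne)
  set α := alphaCo n (s + 1) (s + q + 1) with hα
  set ν := addAlpha n (s + 1) (s + q + 1) μ with hν
  have hαν : -α + ν = μ := by
    funext i; simp [hν, hα, addAlpha]
  refine ⟨u, h, tPow (-ν) * l * tPow ν * l₂, hu, hh, ?_, ?_⟩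
  · exact (hl.1.conj ν).mul hl₂.1
  · rw [blockEmbed_ymat_eq hn he]
    have e1 : leadUpper n s q p e b g * tPow (-α) * leadCongr n s q p e b g *
        (u₂ * h₂ * tPow ν * l₂) = leadUpper n s q p e b g * tPow (-α) *
          (leadCongr n s q p e b g * u₂ * h₂) * tPow ν * l₂ := by
      simp only [Matrix.mul_assoc]
    have e2 : tPow α * (h * tPow μ) * (tPow (-ν) * l * tPow ν * l₂) = h * l * tPow ν * l₂ := by
      have : h * tPow μ = tPow (-α) * h * tPow ν := by
        rw [Matrix.mul_assoc, tPow_commute hh ν, ← Matrix.mul_assoc, tPow_mul_tPow, hαν,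
          tPow_commute hh]
      calc tPow α * (h * tPow μ) * (tPow (-ν) * l * tPow ν * l₂)
          = (tPow α * tPow (-α)) * h * (tPow ν * tPow (-ν)) * l * tPow ν * l₂ := by
            rw [this]; simp only [Matrix.mul_assoc]
        _ = h * l * tPow ν * l₂ := by
            rw [tPow_mul_tPow, tPow_mul_tPow, add_neg_cancel, add_neg_cancel, tPow_zero,
              Matrix.one_mul, Matrix.mul_one]
    calc _ = leadUpper n s q p e b g * tPow (-α) * (u * h * l) * tPow ν * l₂ := by rw [e1, hM]
      _ = leadUpper n s q p e b g * tPow (-α) * u * (h * l * tPow ν * l₂) := by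
          simp only [Matrix.mul_assoc]
      _ = _ := by rw [← e2]; simp only [Matrix.mul_assoc]

/-- On the block `{s,…,s+q+1}`, the `N₁[[t⁻¹]]`-factor of `m(y₁,y₂)` agrees with `leadUpper` up to
high order. -/
lemma vanishBelow_sub_leadUpper (hn : s + q + 1 < n) {p e : ℂ} (he : e ≠ 0) {b g : Fin q → ℂ}
    {μ : Fin n → ℤ} {y₂ z U h L : Matrix (Fin n) (Fin n) K}
    (hy₂ : y₂ ∈ GrSlice (addAlpha n (s + 1) (s + q + 1) μ))
    (hz : IsPiOf μ (blockEmbed n (s + 1) (q + 1) (ymat (q + 1) p e b g) * y₂) z)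
    (hg : IsGauss μ z U h L) {i j : Fin n} (hi : s ≤ i) (hij : i < j)
    (hj : (j : ℕ) ≤ s + q + 1) :
    VanishBelow (1 + alphaCo n (s + 1) (s + q + 1) i - alphaCo n (s + 1) (s + q + 1) j)
      (U i j - leadUpper n s q p e b g i j) := by
  obtain ⟨u, h', L', hu, hh', hL', hx⟩ := exists_factor_mul hn he b g hy₂
  obtain ⟨_, a, c, ha, hc, hz⟩ := hz
  have hA := isUpperUni_leadUpper (n := n) (s := s) p e b g
  have hA1 := congrOne_leadUpper (n := n) (s := s) p e b g
  have hW := hA.mul (hu.1.conj (alphaCo n (s + 1) (s + q + 1)))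
  rw [hx] at hz
  have hU := IsGauss.upper_eq hW hh' hL' ha.1 hc.1 hz hg
  have hUW := block_eq_of_poly_mul hW ha hU (s := s) (e := s + q + 1) ?_ ?_ i j hi hij hj
  · rw [hUW]
    exact vanishBelow_mul_conj_sub hA hA1 hu hi hij hj
  · intro i j hi hij hj
    have h0 := vanishBelow_mul_conj_sub (q := q) hA hA1 hu hi hij hj
    have h1 := hA1 i j
    rw [Matrix.sub_apply, Matrix.one_apply_ne hij.ne, sub_zero] at h1
    have h2 := (alphaCo_bounds s q i).1 (by omega)
    have h3 := (alphaCo_bounds s q j).2.1 (by omega)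
    simpa using (h0.mono (by omega)).add h1
  · intro i j _ hij _
    have := (memN1_iff.1 hg.1).2 i j
    rwa [Matrix.sub_apply, Matrix.one_apply_ne hij.ne, sub_zero] at this

lemma coeff_const_mul_inv (z : ℂ) : (Cc z * tK⁻¹).coeff 1 = z := by
  have := Cc_mul_zpow z (-1)
  rw [_root_.zpow_neg_one] at this
  rw [this]; simp

lemma coeff_two_const_mul_inv (z : ℂ) : (Cc z * tK⁻¹).coeff 2 = 0 := by
  have := Cc_mul_zpow z (-1)
  rw [_root_.zpow_neg_one] at this
  rw [this]; simp

lemma coeff_const_mul_inv_inv (z : ℂ) :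
    (Cc z * tK⁻¹ * tK⁻¹).coeff 1 = 0 ∧ (Cc z * tK⁻¹ * tK⁻¹).coeff 2 = z := by
  have := Cc_mul_zpow z (-2)
  have h2 : tK ^ (-2 : ℤ) = tK⁻¹ * tK⁻¹ := by rw [← _root_.zpow_neg_one, ← zpow_add₀ tK_ne_zero]; norm_num
  rw [mul_assoc, ← h2, this]
  constructor <;> simp

lemma leadUpper_last_coeff {p e : ℂ} {b g : Fin q → ℂ} {i j : Fin n} (hij : i ≠ j)
    (hi : (i : ℕ) ≠ s) (hj : (j : ℕ) = s + q + 1) :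
    (leadUpper n s q p e b g i j).coeff 1 = extendMid s q b i := by
  rw [leadUpper, if_neg hij, if_neg hi, if_pos hj, zero_add, zero_add, coeff_const_mul_inv]

lemma leadUpper_corner_coeff {p e : ℂ} {b g : Fin q → ℂ} {i j : Fin n}
    (hi : (i : ℕ) = s) (hj : (j : ℕ) = s + q + 1) :
    (leadUpper n s q p e b g i j).coeff 1 = e ∧
      (leadUpper n s q p e b g i j).coeff 2 = e * (p + ∑ l, b l * g l) := by
  have hij : i ≠ j := fun h => by rw [h] at hi; omega
  rw [leadUpper, if_neg hij, if_pos hi, if_pos hj, if_pos hj, extendMid_of_not b (by omega),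
    extendMid_of_not g (by omega), mul_zero, Cc_zero, zero_mul, zero_add, add_zero, add_zero]
  rw [HahnSeries.coeff_add, HahnSeries.coeff_add, coeff_const_mul_inv, coeff_two_const_mul_inv,
    (coeff_const_mul_inv_inv _).1, (coeff_const_mul_inv_inv _).2, add_zero, zero_add]
  exact ⟨rfl, rfl⟩

lemma leadUpper_first_coeff {p e : ℂ} {b g : Fin q → ℂ} {i j : Fin n} (hij : i ≠ j)
    (hi : (i : ℕ) = s) (hj : (j : ℕ) ≠ s + q + 1) :
    (leadUpper n s q p e b g i j).coeff 1 = e * extendMid s q g j := by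
  rw [leadUpper, if_neg hij, if_pos hi, if_neg hj, if_neg hj, zero_add, zero_add, add_zero,
    coeff_const_mul_inv]

lemma VanishBelow.coeff_eq {d : ℤ} {f f' : K} (h : VanishBelow d (f - f')) {j : ℤ} (hj : j < d) :
    f.coeff j = f'.coeff j := by
  have := h j hj
  rwa [HahnSeries.coeff_sub, sub_eq_zero] at this

lemma phiOf_zetaOf_eq (hn : s + q + 1 < n) {p e : ℂ} (he : e ≠ 0) {b g : Fin q → ℂ}
    {μ : Fin n → ℤ} {y₂ z U h L : Matrix (Fin n) (Fin n) K}
    (hy₂ : y₂ ∈ GrSlice (addAlpha n (s + 1) (s + q + 1) μ))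
    (hz : IsPiOf μ (blockEmbed n (s + 1) (q + 1) (ymat (q + 1) p e b g) * y₂) z)
    (hg : IsGauss μ z U h L) (h1 : 1 ≤ s + 1) (h2 : s + 1 ≤ s + q + 1)
    (h3 : q + 1 = s + q + 1 - (s + 1) + 1) :
    PhiOf n (s + q + 1) (q + 1) hn U =
        (fun a : Fin (q + 1) => if ha : (a : ℕ) < q + 1 - 1 then b ⟨(a : ℕ), ha⟩ else e) ∧
      ZetaOf n (s + 1) (s + q + 1) (q + 1) h1 h2 hn h3 U =
        (fun a : Fin (q + 1) => if ha : (a : ℕ) < q + 1 - 1 then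
            e * g ⟨q + 1 - 2 - (a : ℕ), by omega⟩
          else e * (p + ∑ i : Fin (q + 1 - 1), b i * g i)) := by
  have key : ∀ {i j : Fin n}, s ≤ i → i < j → (j : ℕ) ≤ s + q + 1 → _ :=
    fun hi hij hj => vanishBelow_sub_leadUpper hn he hy₂ hz hg hi hij hj
  have hs : ∀ hs : s < n, alphaCo n (s + 1) (s + q + 1) ⟨s, hs⟩ = 1 := fun hs => by simp [alphaCo]
  have hl : alphaCo n (s + 1) (s + q + 1) ⟨s + q + 1, hn⟩ = -1 := by
    simp [alphaCo]; omega
  have hm : ∀ i : Fin n, s < i → (i : ℕ) < s + q + 1 → alphaCo n (s + 1) (s + q + 1) i = 0 := by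
    intro i hi hi'
    rw [alphaCo, if_neg (by omega), if_neg (by omega)]
  have hlt : ∀ {i : ℕ} (hi : i < n), i < s + q + 1 → (⟨i, hi⟩ : Fin n) < ⟨s + q + 1, hn⟩ :=
    fun hi h => h
  constructor
  · funext a
    have hi : s + q + 1 - 1 - (a : ℕ) < n := by omega
    rw [PhiOf]
    by_cases ha : (a : ℕ) < q
    · rw [dif_pos (show (a : ℕ) < q + 1 - 1 from ha),
        (key (i := ⟨s + q + 1 - 1 - (a : ℕ), hi⟩) (j := ⟨s + q + 1, hn⟩) (by simp only []; omega)
          (hlt hi (by omega)) le_rfl).coeff_eq (by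
            rw [hl, hm _ (by simp only []; omega) (by simp only []; omega)]; norm_num),
        leadUpper_last_coeff (hlt hi (by omega)).ne (by simp only []; omega) rfl,
        extendMid, dif_pos (by simp only []; omega)]
      exact congrArg b (Fin.ext (show s + q - (s + q + 1 - 1 - (a : ℕ)) = a by omega))
    · have hs' : s + q + 1 - 1 - (a : ℕ) = s := by omega
      rw [dif_neg (show ¬(a : ℕ) < q + 1 - 1 from ha)]
      simp only [hs']
      rw [(key (i := ⟨s, by omega⟩) (j := ⟨s + q + 1, hn⟩) le_rfl
          (hlt _ (by omega)) le_rfl).coeff_eq (by rw [hl, hs]; norm_num),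
        (leadUpper_corner_coeff (i := ⟨s, by omega⟩) (j := ⟨s + q + 1, hn⟩) rfl rfl).1]
  · funext a
    rw [ZetaOf]
    by_cases ha : (a : ℕ) < q
    · have hj : s + 1 + (a : ℕ) < n := by omega
      have hsj : (⟨s + 1 - 1, by omega⟩ : Fin n) < ⟨s + 1 + (a : ℕ), hj⟩ :=
        show s + 1 - 1 < s + 1 + (a : ℕ) by omega
      rw [dif_pos (show (a : ℕ) < q + 1 - 1 from ha), dif_neg (by omega),
        (key (i := ⟨s + 1 - 1, by omega⟩) (j := ⟨s + 1 + (a : ℕ), hj⟩) le_rfl hsj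
          (by simp only []; omega)).coeff_eq (by
            rw [hm ⟨s + 1 + (a : ℕ), hj⟩ (by simp only []; omega) (by simp only []; omega)]
            simp only [Nat.add_sub_cancel, hs]; norm_num),
        leadUpper_first_coeff (s := s) (q := q) hsj.ne rfl (by simp only []; omega),
        extendMid, dif_pos (by simp only []; omega)]
      exact congrArg (fun x => e * g x)
        (Fin.ext (show s + q - (s + 1 + (a : ℕ)) = q + 1 - 2 - a by omega))
    · rw [dif_neg (show ¬(a : ℕ) < q + 1 - 1 from ha), dif_pos (by omega)]
      simp only [Nat.add_sub_cancel]
      rw [(key (i := ⟨s, by omega⟩) (j := ⟨s + q + 1, hn⟩) le_rfl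
          (hlt _ (by omega)) le_rfl).coeff_eq (by rw [hl, hs]; norm_num)]
      exact (leadUpper_corner_coeff rfl rfl).2

lemma one_mem_grSlice_zero : (1 : Matrix (Fin n) (Fin n) K) ∈ GrSlice 0 := by
  refine ⟨1, 1, 1, MemN1.one, ⟨fun i j => Matrix.one_apply_ne, fun i => ?_⟩, MemN1neg.one, ?_⟩
  · rw [Matrix.one_apply_eq, sub_self]; exact fun _ _ => rfl
  · simp [tPow_zero]

lemma memPoly_one_apply (i j : Fin n) : memPoly ((1 : Matrix (Fin n) (Fin n) K) i j) := by
  intro k hk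
  rw [Matrix.one_apply]
  split_ifs
  · rw [HahnSeries.coeff_one, if_neg hk.ne']
  · rfl

lemma isPiOf_self {μ : Fin n → ℤ} {z : Matrix (Fin n) (Fin n) K} (hz : z ∈ GrSlice μ) :
    IsPiOf μ z z :=
  ⟨hz, 1, 1, ⟨.one, memPoly_one_apply⟩, ⟨MemN1neg.one.1, memPoly_one_apply⟩, by simp⟩

end

/-- `Φ_α(m(y₁,y₂)) = Φ_α(y₁) = (b₁,…,b_{k−1},e)` and
`ζ_α(m(y₁,y₂)) = ζ_α(y₁) = (e g_{k−1},…,e g₁, e(p + ∑ b_i g_i))`, where `Φ_α, ζ_α`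
are read off from the unique `N₁[[t⁻¹]]`-factor of a Gauss factorization. -/
theorem statement9 (n r₁ r₂ k : ℕ) (hn : 2 ≤ n) (hr1 : 1 ≤ r₁) (hrr : r₁ ≤ r₂)
    (hrn : r₂ < n) (hk : k = r₂ - r₁ + 1) (μ : Fin n → ℤ)
    (p e : ℂ) (he : e ≠ 0) (b g : Fin (k-1) → ℂ)
    (y₂ : Matrix (Fin n) (Fin n) K) (hy₂ : y₂ ∈ GrSlice (addAlpha n r₁ r₂ μ)) :
    (∃ z, IsPiOf μ (blockEmbed n r₁ k (ymat k p e b g) * y₂) z) ∧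
    (∀ z, IsPiOf μ (blockEmbed n r₁ k (ymat k p e b g) * y₂) z →
      ∀ U h L : Matrix (Fin n) (Fin n) K, IsGauss μ z U h L →
        PhiOf n r₂ k hrn U =
          (fun a : Fin k => if ha : (a : ℕ) < k - 1 then b ⟨(a : ℕ), ha⟩ else e) ∧
        ZetaOf n r₁ r₂ k hr1 hrr hrn hk U =
          (fun a : Fin k => if ha : (a : ℕ) < k - 1 then
              e * g ⟨k - 2 - (a : ℕ), by omega⟩
            else e * (p + ∑ i : Fin (k-1), b i * g i))) ∧
    (∀ U h L : Matrix (Fin n) (Fin n) K,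
      IsGauss (fun i => -alphaCo n r₁ r₂ i) (blockEmbed n r₁ k (ymat k p e b g)) U h L →
        PhiOf n r₂ k hrn U =
          (fun a : Fin k => if ha : (a : ℕ) < k - 1 then b ⟨(a : ℕ), ha⟩ else e) ∧
        ZetaOf n r₁ r₂ k hr1 hrr hrn hk U =
          (fun a : Fin k => if ha : (a : ℕ) < k - 1 then
              e * g ⟨k - 2 - (a : ℕ), by omega⟩
            else e * (p + ∑ i : Fin (k-1), b i * g i))) := by
  obtain ⟨s, rfl⟩ : ∃ s, r₁ = s + 1 := ⟨r₁ - 1, by omega⟩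
  obtain ⟨q, rfl⟩ : ∃ q, k = q + 1 := ⟨k - 1, by omega⟩
  obtain rfl : r₂ = s + q + 1 := by omega
  refine ⟨?_, fun z hz U h L hg => phiOf_zetaOf_eq hrn he hy₂ hz hg hr1 hrr hk,
    fun U h L hg => ?_⟩
  · obtain ⟨u, h, L, hu, hh, hL, hx⟩ := exists_factor_mul (p := p) hrn he b g hy₂
    rw [hx]
    exact exists_isPiOf ((isUpperUni_leadUpper p e b g).mul (hu.1.conj _)) hh hL
  · have h0 : addAlpha n (s + 1) (s + q + 1) (fun i => -alphaCo n (s + 1) (s + q + 1) i) = 0 := by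
      funext i; simp [addAlpha]
    refine phiOf_zetaOf_eq hrn he (h0 ▸ one_mem_grSlice_zero) ?_ hg hr1 hrr hk
    rw [Matrix.mul_one]
    exact isPiOf_self ⟨U, h, L, hg⟩

end
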